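/- Let (R, m) be a Noetherian local ring with m ≠ 0. Then ms(R) ≥ ⌈μ(m²)/μ(m)⌉. Moreover, if ms(R) = 1, then μ(m^{n+1}) ≤ μ(mⁿ) for every integer n ≥ 1. -/

import Mathlib

open IsLocalRing

/-- The minimal number of generators of an ideal. -/
noncomputable def mu {R : Type*} [CommRing R] (I : Ideal R) : ℕ :=
  sInf {n : ℕ | ∃ s : Finset R, s.card = n ∧ Ideal.span (s : Set R) = I}

/-- `ms R = min {μ(I) : m² ⊆ I ⊆ m}`. -/
noncomputable def ms (R : Type*) [CommRing R] [IsLocalRing R] : ℕ :=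
  sInf {n : ℕ | ∃ I : Ideal R,
    (maximalIdeal R) ^ 2 ≤ I ∧ I ≤ maximalIdeal R ∧ mu I = n}

theorem mu_le' {R : Type*} [CommRing R] (s : Finset R) : mu (Ideal.span (s : Set R)) ≤ s.card :=
  Nat.sInf_le ⟨s, rfl, rfl⟩

theorem mu_spec' {R : Type*} [CommRing R] [IsNoetherianRing R] (I : Ideal R) :
    ∃ s : Finset R, s.card = mu I ∧ Ideal.span (s : Set R) = I := by
  obtain ⟨s, hs⟩ := (IsNoetherian.noetherian I : I.FG)
  exact Nat.sInf_mem (s := {n : ℕ | ∃ s : Finset R, s.card = n ∧ Ideal.span (s : Set R) = I})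
    ⟨s.card, s, rfl, hs⟩

theorem mu_mul_le' {R : Type*} [CommRing R] [IsNoetherianRing R] (I J : Ideal R) :
    mu (I * J) ≤ mu I * mu J := by
  classical
  obtain ⟨s, hs, hI⟩ := mu_spec' I
  obtain ⟨t, ht, hJ⟩ := mu_spec' J
  have h : I * J = Ideal.span ((Finset.image₂ (· * ·) s t : Finset R) : Set R) := by
    rw [← hI, ← hJ, Ideal.span_mul_span', Finset.coe_image₂, Set.image2_mul]
  rw [h, ← hs, ← ht]
  exact (mu_le' _).trans (Finset.card_image₂_le _ _ _)

theorem mu_sup_le' {R : Type*} [CommRing R] [IsNoetherianRing R] (I J : Ideal R) :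
    mu (I ⊔ J) ≤ mu I + mu J := by
  classical
  obtain ⟨s, hs, hI⟩ := mu_spec' I
  obtain ⟨t, ht, hJ⟩ := mu_spec' J
  have h : I ⊔ J = Ideal.span ((s ∪ t : Finset R) : Set R) := by
    rw [← hI, ← hJ, Finset.coe_union, Ideal.span_union]
  rw [h, ← hs, ← ht]
  exact (mu_le' _).trans (Finset.card_union_le _ _)

theorem exch' {R : Type*} [CommRing R] [IsLocalRing R] [IsNoetherianRing R] (I J : Ideal R)
    (hJI : J ≤ I) (hmI : maximalIdeal R * I ≤ J) :
    ∃ t1 t2 : Finset R, t1.card + t2.card ≤ mu I ∧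
      J = Ideal.span (t1 : Set R) ⊔ maximalIdeal R * Ideal.span (t2 : Set R) := by
  classical
  obtain ⟨T, hT, hI⟩ := mu_spec' I
  obtain ⟨t, ht, hmin⟩ := Finset.exists_min_image
    (T.powerset.filter (fun t : Finset R => Ideal.span (t : Set R) ⊔ J = I)) Finset.card
    ⟨T, by simp [hI, hJI]⟩
  simp only [Finset.mem_filter, Finset.mem_powerset] at ht hmin
  obtain ⟨htT, htI⟩ := ht
  have key : ∀ p ∈ Ideal.span (t : Set R), p ∈ J →
      p ∈ maximalIdeal R * Ideal.span (t : Set R) := by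
    intro p hp hpJ
    obtain ⟨a, -, rfl⟩ := Submodule.mem_span_finset.1 hp
    refine Ideal.sum_mem _ fun x hx => Ideal.mul_mem_mul ?_ (Ideal.subset_span hx)
    by_contra hu
    have hu : IsUnit (a x) := by simpa using hu
    have hx' : x ∈ Ideal.span ((t.erase x : Finset R) : Set R) ⊔ J := by
      rw [← Ideal.unit_mul_mem_iff_mem _ hu]
      rw [← Finset.add_sum_erase _ _ hx] at hpJ
      have h2 : ∑ y ∈ t.erase x, a y • y ∈ Ideal.span ((t.erase x : Finset R) : Set R) :=
        Ideal.sum_mem _ fun y hy => Ideal.mul_mem_left _ _ (Ideal.subset_span hy)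
      have := sub_mem (Ideal.mem_sup_right (S := Ideal.span ((t.erase x : Finset R) : Set R)) hpJ)
        (Ideal.mem_sup_left (T := J) h2)
      simpa using this
    have hle := hmin (t.erase x) ⟨(Finset.erase_subset _ _).trans htT, by
      apply le_antisymm
      · rw [← htI]
        exact sup_le_sup_right (Ideal.span_mono (by simp)) _
      · rw [← htI]
        refine sup_le (Ideal.span_le.2 fun y hy => ?_) le_sup_right
        by_cases hyx : y = x
        · exact hyx ▸ hx'
        · exact Ideal.mem_sup_left (Ideal.subset_span (by simp_all))⟩
    have := Finset.card_erase_lt_of_mem hx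
    omega
  have hdec : ∀ z : R, ∃ j ∈ J, z ∈ I → z - j ∈ Ideal.span (t : Set R) := by
    intro z
    by_cases hz : z ∈ I
    · rw [← htI] at hz
      obtain ⟨p, hp, j, hj, rfl⟩ := Submodule.mem_sup.1 hz
      exact ⟨j, hj, fun _ => by simpa using hp⟩
    · exact ⟨0, J.zero_mem, fun h => absurd h hz⟩
  choose j hj hjz using hdec
  have hs1 : Ideal.span (((T \ t).image j : Finset R) : Set R) ≤ J := by
    refine Ideal.span_le.2 fun y hy => ?_
    obtain ⟨z, -, rfl⟩ := Finset.mem_image.1 (Finset.mem_coe.1 hy)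
    exact hj z
  refine ⟨(T \ t).image j, t, ?_, le_antisymm ?_ ?_⟩
  · have h1 := Finset.card_image_le (s := T \ t) (f := j)
    have h2 := Finset.card_sdiff_add_card_eq_card htT
    omega
  · have hle : I ≤ Ideal.span (t : Set R) ⊔
        Ideal.span (((T \ t).image j : Finset R) : Set R) := by
      rw [← hI, Ideal.span_le]
      intro z hz
      by_cases hzt : z ∈ t
      · exact Ideal.mem_sup_left (Ideal.subset_span hzt)
      · have h1 := hjz z (hI ▸ Ideal.subset_span hz)
        have h2 : j z ∈ Ideal.span (((T \ t).image j : Finset R) : Set R) :=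
          Ideal.subset_span (Finset.mem_coe.2 (Finset.mem_image_of_mem _
            (Finset.mem_sdiff.2 ⟨hz, hzt⟩)))
        have := Submodule.add_mem_sup h1 h2
        simpa using this
    intro y hy
    obtain ⟨p, hp, q, hq, rfl⟩ := Submodule.mem_sup.1 (hle (hJI hy))
    have hpJ : p ∈ J := by simpa using sub_mem hy (hs1 hq)
    rw [add_comm]
    exact Submodule.add_mem_sup hq (key p hp hpJ)
  · refine sup_le hs1 (le_trans (Ideal.mul_mono_right ?_) hmI)
    rw [← htI]; exact le_sup_left

theorem ms_spec' (R : Type*) [CommRing R] [IsLocalRing R] :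
    ∃ I : Ideal R, (maximalIdeal R) ^ 2 ≤ I ∧ I ≤ maximalIdeal R ∧ mu I = ms R :=
  Nat.sInf_mem (s := {n : ℕ | ∃ I : Ideal R,
    (maximalIdeal R) ^ 2 ≤ I ∧ I ≤ maximalIdeal R ∧ mu I = n})
    ⟨_, maximalIdeal R, Ideal.pow_le_self two_ne_zero, le_rfl, rfl⟩

theorem red' {R : Type*} [CommRing R] [IsLocalRing R] [IsNoetherianRing R] (x : R)
    (h1 : (maximalIdeal R) ^ 2 ≤ Ideal.span {x}) (hx : x ∈ maximalIdeal R) :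
    ∃ a : R, (maximalIdeal R) ^ 2 = Ideal.span {a} * maximalIdeal R := by
  have fin : ∀ a ∈ maximalIdeal R, (maximalIdeal R) ^ 2 ≤ Ideal.span {a} * maximalIdeal R →
      ∃ a : R, (maximalIdeal R) ^ 2 = Ideal.span {a} * maximalIdeal R := fun a ha h =>
    ⟨a, le_antisymm h (by
      rw [sq]; exact Ideal.mul_mono_left ((Ideal.span_singleton_le_iff_mem _).2 ha))⟩
  by_cases hx2 : x ∈ (maximalIdeal R) ^ 2
  · by_cases hab : ∃ a ∈ maximalIdeal R, ∃ b ∈ maximalIdeal R, ∃ u, IsUnit u ∧ a * b = u * x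
    · obtain ⟨a, ha, b, hb, u, hu, h⟩ := hab
      refine fin a ha (h1.trans ((Ideal.span_singleton_le_iff_mem _).2 ?_))
      rw [← Ideal.unit_mul_mem_iff_mem _ hu, ← h]
      exact Ideal.mul_mem_mul (Ideal.mem_span_singleton_self a) hb
    · have hz : (maximalIdeal R) ^ 2 = ⊥ := by
        refine Submodule.eq_bot_of_le_smul_of_le_jacobson_bot (maximalIdeal R) _
          (IsNoetherian.noetherian _) ?_ (IsLocalRing.maximalIdeal_le_jacobson _)
        conv_lhs => rw [sq]
        rw [Ideal.mul_le]
        intro a ha b hb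
        have : a * b ∈ (maximalIdeal R) ^ 2 := by rw [sq]; exact Ideal.mul_mem_mul ha hb
        obtain ⟨u, hu⟩ := Ideal.mem_span_singleton'.1 (h1 this)
        rw [← hu]
        refine Submodule.smul_mem_smul ?_ hx2
        by_contra hn
        exact hab ⟨a, ha, b, hb, u, by simpa using hn, hu.symm⟩
      exact ⟨0, by rw [hz]; simp⟩
  · refine fin x hx fun y hy => ?_
    obtain ⟨u, rfl⟩ := Ideal.mem_span_singleton'.1 (h1 hy)
    rw [mul_comm u x]
    refine Ideal.mul_mem_mul (Ideal.mem_span_singleton_self x) ?_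
    by_contra hn
    exact hx2 ((Ideal.unit_mul_mem_iff_mem _ (by simpa using hn)).1 hy)

/-- Let `(R, m)` be a Noetherian local ring with `m ≠ 0`.  Then
`ms(R) ≥ ⌈μ(m²)/μ(m)⌉`.  Moreover, if `ms(R) = 1`, then `μ(m^{n+1}) ≤ μ(mⁿ)` for every
integer `n ≥ 1`. -/
theorem stmt7 {R : Type*} [CommRing R] [IsLocalRing R] [IsNoetherianRing R]
    (hm : maximalIdeal R ≠ ⊥) :
    (⌈(mu ((maximalIdeal R) ^ 2) : ℚ) / (mu (maximalIdeal R) : ℚ)⌉ ≤ (ms R : ℤ)) ∧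
    (ms R = 1 → ∀ n : ℕ, 1 ≤ n →
      mu ((maximalIdeal R) ^ (n + 1)) ≤ mu ((maximalIdeal R) ^ n)) := by
  obtain ⟨I, h2I, hIm, hmu⟩ := ms_spec' R
  constructor
  · have he : 0 < mu (maximalIdeal R) := by
      obtain ⟨s, hs, hI⟩ := mu_spec' (maximalIdeal R)
      rw [← hs, Finset.card_pos, Finset.nonempty_iff_ne_empty]
      rintro rfl
      exact hm (by rw [← hI]; simp)
    obtain ⟨t1, t2, hc, hJ⟩ := exch' I ((maximalIdeal R) ^ 2) h2I
      (by rw [sq]; exact Ideal.mul_mono_right hIm)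
    have hb : mu ((maximalIdeal R) ^ 2) ≤ ms R * mu (maximalIdeal R) := by
      rw [← hmu]
      have a1 := mu_le' t1
      have a2 := mu_le' t2
      have a3 := mu_sup_le' (Ideal.span (t1 : Set R)) (maximalIdeal R * Ideal.span (t2 : Set R))
      have a4 := mu_mul_le' (maximalIdeal R) (Ideal.span (t2 : Set R))
      rw [← hJ] at a3
      nlinarith
    rw [Int.ceil_le, div_le_iff₀ (by exact_mod_cast he)]
    exact_mod_cast hb
  · intro h1 n hn
    obtain ⟨s, hs, hI⟩ := mu_spec' I
    rw [hmu, h1, Finset.card_eq_one] at hs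
    obtain ⟨x, rfl⟩ := hs
    rw [Finset.coe_singleton] at hI
    subst hI
    obtain ⟨a, ha⟩ := red' x h2I ((Ideal.span_singleton_le_iff_mem _).1 hIm)
    obtain ⟨k, rfl⟩ := Nat.exists_eq_add_of_le' hn
    have : (maximalIdeal R) ^ (k + 1 + 1) = Ideal.span {a} * (maximalIdeal R) ^ (k + 1) := by
      rw [add_assoc, pow_add, one_add_one_eq_two, ha, pow_succ]; ring
    rw [this]
    have h3 := mu_mul_le' (Ideal.span {a}) ((maximalIdeal R) ^ (k + 1))
    have h4 := mu_le' ({a} : Finset R)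
    simp only [Finset.coe_singleton, Finset.card_singleton] at h4
    nlinarith
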